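/- Assume cos θ ≠ 0. Then every eigenvalue μ of P_C A is real and satisfies min{1 + λ_min(Λ), λ_min(Λ_⊥)} − ε_C ≤ μ ≤ max{1 + λ_max(Λ), λ_max(Λ_⊥)} + ε_C, where ε_C = (1/2)(λ_max(Λ_⊥) ‖E⁻¹‖₂ + 1) tan θ + sin θ + sin²θ. -/

import Mathlib

open Matrix

/-- The Euclidean (2-)norm of a vector in `ℝ^k`. -/
noncomputable def euclNorm {k : ℕ} (x : Fin k → ℝ) : ℝ := Real.sqrt (∑ i, x i ^ 2)

/-- The largest singular value of a real matrix:
`σ_max(M) = max_{‖x‖₂ = 1} ‖M x‖₂`.  For a square matrix this is the spectral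
norm `‖M‖₂`. -/
noncomputable def sigmaMax {m k : ℕ} (M : Matrix (Fin m) (Fin k) ℝ) : ℝ :=
  sSup {c : ℝ | ∃ x : Fin k → ℝ, euclNorm x = 1 ∧ c = euclNorm (M.mulVec x)}

/-- The smallest singular value of a real matrix:
`σ_min(M) = min_{‖x‖₂ = 1} ‖M x‖₂`. -/
noncomputable def sigmaMin {m k : ℕ} (M : Matrix (Fin m) (Fin k) ℝ) : ℝ :=
  sInf {c : ℝ | ∃ x : Fin k → ℝ, euclNorm x = 1 ∧ c = euclNorm (M.mulVec x)}

section DotProduct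

variable {ι κ : Type*} [Fintype ι] [Fintype κ]

lemma dotProduct_self_nonneg_real (x : ι → ℝ) : 0 ≤ x ⬝ᵥ x :=
  Finset.sum_nonneg fun _ _ => mul_self_nonneg _

/-- Cauchy–Schwarz for the dot product. -/
lemma dotProduct_sq_le (x y : ι → ℝ) : (x ⬝ᵥ y) ^ 2 ≤ (x ⬝ᵥ x) * (y ⬝ᵥ y) := by
  simpa only [dotProduct, sq] using Finset.sum_mul_sq_le_sq_mul_sq Finset.univ x y

/-- The defining property of the transpose, in dot-product form. -/
lemma mulVec_dotProduct_eq (M : Matrix ι κ ℝ) (x : κ → ℝ) (y : ι → ℝ) :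
    M *ᵥ x ⬝ᵥ y = x ⬝ᵥ Mᵀ *ᵥ y := by
  rw [dotProduct_transpose_mulVec, dotProduct_comm]

lemma mulVec_dotProduct_self_of_transpose_mul_self [DecidableEq κ] {M : Matrix ι κ ℝ}
    (hM : Mᵀ * M = 1) (x : κ → ℝ) : M *ᵥ x ⬝ᵥ M *ᵥ x = x ⬝ᵥ x := by
  rw [mulVec_dotProduct_eq, mulVec_mulVec, hM, one_mulVec]

/-- A bound on the norm of `M` passes to its transpose. -/
lemma transpose_mulVec_dotProduct_self_le {M : Matrix ι κ ℝ} {K : ℝ} (hK : 0 ≤ K)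
    (hM : ∀ x, M *ᵥ x ⬝ᵥ M *ᵥ x ≤ K * (x ⬝ᵥ x)) (y : ι → ℝ) :
    Mᵀ *ᵥ y ⬝ᵥ Mᵀ *ᵥ y ≤ K * (y ⬝ᵥ y) := by
  have h1 : Mᵀ *ᵥ y ⬝ᵥ Mᵀ *ᵥ y = y ⬝ᵥ M *ᵥ (Mᵀ *ᵥ y) := by
    rw [mulVec_dotProduct_eq, transpose_transpose]
  have h2 := dotProduct_sq_le y (M *ᵥ (Mᵀ *ᵥ y))
  rw [← h1] at h2
  have h3 := hM (Mᵀ *ᵥ y)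
  have h4 := dotProduct_self_nonneg_real (Mᵀ *ᵥ y)
  have h5 := dotProduct_self_nonneg_real y
  generalize Mᵀ *ᵥ y ⬝ᵥ Mᵀ *ᵥ y = a at *
  rcases h4.eq_or_lt with h | h
  · rw [← h]; positivity
  · nlinarith [mul_le_mul_of_nonneg_left h3 h5]

end DotProduct

section Projections

variable {ι : Type*} [Fintype ι]

/-- If `P`, `Q` are orthogonal projections such that `‖q - P q‖² ≤ K ‖q‖²` on the range of `Q`,
and `P` maps the range of `Q` onto the range of `P`, then `‖p - Q p‖² ≤ K ‖p‖²` on the range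
of `P`. -/
lemma projection_gap_symm {P Q : Matrix ι ι ℝ} (hPt : Pᵀ = P) (hQt : Qᵀ = Q) {K : ℝ}
    (hgap : ∀ q, Q *ᵥ q = q → q ⬝ᵥ q - P *ᵥ q ⬝ᵥ P *ᵥ q ≤ K * (q ⬝ᵥ q))
    (hsurj : ∀ y, ∃ q, Q *ᵥ q = q ∧ P *ᵥ q = P *ᵥ y) (p : ι → ℝ) (hp : P *ᵥ p = p) :
    p ⬝ᵥ p - Q *ᵥ p ⬝ᵥ Q *ᵥ p ≤ K * (p ⬝ᵥ p) := by
  obtain ⟨q, hq, hPq⟩ := hsurj p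
  rw [hp] at hPq
  have h1 := hgap q hq
  rw [hPq] at h1
  have hpq : p ⬝ᵥ q = p ⬝ᵥ p := by
    nth_rw 1 [← hp]
    rw [mulVec_dotProduct_eq, hPt, hPq]
  have h2 := dotProduct_sq_le (Q *ᵥ p) q
  rw [mulVec_dotProduct_eq Q p q, hQt, hq, hpq] at h2
  have ha := dotProduct_self_nonneg_real p
  have he := dotProduct_self_nonneg_real (Q *ᵥ p)
  rcases (dotProduct_self_nonneg_real q).eq_or_lt with hb | hb
  · have : p = 0 := by
      rw [← hPq, dotProduct_self_eq_zero.mp hb.symm, mulVec_zero]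
    simp [this]
  · refine le_of_mul_le_mul_right ?_ hb
    nlinarith [mul_le_mul_of_nonneg_left h1 ha]

/-- Two-sided bound on the quadratic form of a difference of orthogonal projections. -/
lemma dotProduct_projection_sub_sq_le {P Q : Matrix ι ι ℝ} (hPt : Pᵀ = P) (hPP : P * P = P)
    (hQt : Qᵀ = Q) (hQQ : Q * Q = Q) {K : ℝ} (hK : 0 ≤ K)
    (hgap : ∀ q, Q *ᵥ q = q → q ⬝ᵥ q - P *ᵥ q ⬝ᵥ P *ᵥ q ≤ K * (q ⬝ᵥ q))
    (hsurj : ∀ y, ∃ q, Q *ᵥ q = q ∧ P *ᵥ q = P *ᵥ y) (y : ι → ℝ) :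
    (y ⬝ᵥ Q *ᵥ y - y ⬝ᵥ P *ᵥ y) ^ 2 ≤ K * (y ⬝ᵥ y) ^ 2 := by
  have idem {R : Matrix ι ι ℝ} (hR : R * R = R) (x : ι → ℝ) : R *ᵥ (R *ᵥ x) = R *ᵥ x := by
    rw [mulVec_mulVec, hR]
  have symP (x z : ι → ℝ) : P *ᵥ x ⬝ᵥ z = x ⬝ᵥ P *ᵥ z := by
    rw [mulVec_dotProduct_eq, hPt]
  have symQ (x z : ι → ℝ) : Q *ᵥ x ⬝ᵥ z = x ⬝ᵥ Q *ᵥ z := by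
    rw [mulVec_dotProduct_eq, hQt]
  have hker (w : ι → ℝ) (hw : Q *ᵥ w = 0) : P *ᵥ w ⬝ᵥ P *ᵥ w ≤ K * (w ⬝ᵥ w) := by
    have h1 := projection_gap_symm hPt hQt hgap hsurj (P *ᵥ w) (idem hPP w)
    have h2 := dotProduct_sq_le w (P *ᵥ w - Q *ᵥ (P *ᵥ w))
    have h3 : w ⬝ᵥ (P *ᵥ w - Q *ᵥ (P *ᵥ w)) = P *ᵥ w ⬝ᵥ P *ᵥ w := by
      rw [dotProduct_sub, ← symQ, hw, zero_dotProduct, symP, idem hPP, sub_zero]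
    have h4 : (P *ᵥ w - Q *ᵥ (P *ᵥ w)) ⬝ᵥ (P *ᵥ w - Q *ᵥ (P *ᵥ w)) =
        P *ᵥ w ⬝ᵥ P *ᵥ w - Q *ᵥ (P *ᵥ w) ⬝ᵥ Q *ᵥ (P *ᵥ w) := by
      have : P *ᵥ w ⬝ᵥ Q *ᵥ (P *ᵥ w) = Q *ᵥ (P *ᵥ w) ⬝ᵥ Q *ᵥ (P *ᵥ w) := by
        rw [symQ (P *ᵥ w), idem hQQ]
      simp only [dotProduct_sub, sub_dotProduct]
      rw [dotProduct_comm (Q *ᵥ (P *ᵥ w)) (P *ᵥ w), this]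
      ring
    rw [h3, h4] at h2
    have h5 := dotProduct_self_nonneg_real w
    have h6 := dotProduct_self_nonneg_real (P *ᵥ w)
    generalize P *ᵥ w ⬝ᵥ P *ᵥ w = a at *
    rcases h6.eq_or_lt with h | h
    · rw [← h]; positivity
    · nlinarith [mul_le_mul_of_nonneg_left h1 h5]
  set q := Q *ᵥ y with hq
  set w := y - q with hw
  have hQq : Q *ᵥ q = q := idem hQQ y
  have hQw : Q *ᵥ w = 0 := by rw [hw, mulVec_sub, hQq, sub_self]
  have hyqw : y = q + w := by simp [hw]
  have hqw : q ⬝ᵥ w = 0 := by rw [hq, symQ, hQw, dotProduct_zero]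
  have hyy : y ⬝ᵥ y = q ⬝ᵥ q + w ⬝ᵥ w := by
    rw [hyqw]
    simp only [dotProduct_add, add_dotProduct, dotProduct_comm w q, hqw]
    ring
  have hD : q - P *ᵥ y = (q - P *ᵥ q) - P *ᵥ w := by
    rw [hyqw, mulVec_add]; abel
  have hDD : (q - P *ᵥ y) ⬝ᵥ (q - P *ᵥ y) =
      (q ⬝ᵥ q - P *ᵥ q ⬝ᵥ P *ᵥ q) + P *ᵥ w ⬝ᵥ P *ᵥ w := by
    have e1 : q ⬝ᵥ P *ᵥ q = P *ᵥ q ⬝ᵥ P *ᵥ q := by rw [symP q, idem hPP]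
    have e2 : q ⬝ᵥ P *ᵥ w = P *ᵥ q ⬝ᵥ P *ᵥ w := by rw [symP q, idem hPP]
    rw [hD]
    simp only [dotProduct_sub, sub_dotProduct, dotProduct_comm (P *ᵥ q) q,
      dotProduct_comm (P *ᵥ w) q, dotProduct_comm (P *ᵥ w) (P *ᵥ q), e1, e2]
    ring
  have h1 : (q - P *ᵥ y) ⬝ᵥ (q - P *ᵥ y) ≤ K * (y ⬝ᵥ y) := by
    rw [hDD, hyy]
    linarith [hgap q hQq, hker w hQw]
  have h2 := dotProduct_sq_le y (q - P *ᵥ y)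
  rw [dotProduct_sub] at h2
  nlinarith [mul_le_mul_of_nonneg_left h1 (dotProduct_self_nonneg_real y)]

end Projections

section Spectrum

variable {ι : Type*} [Fintype ι] [DecidableEq ι]

/-- If `C` has the same characteristic polynomial as a real symmetric matrix `B`, then every
complex eigenvalue of `C` is real and an eigenvalue of `B`. -/
lemma exists_eigenvector_of_mem_spectrum_map {B C : Matrix ι ι ℝ} (hB : B.IsHermitian)
    (hC : C.charpoly = B.charpoly) {μ : ℂ} (hμ : μ ∈ spectrum ℂ (C.map Complex.ofReal)) :
    ∃ (t : ℝ) (v : ι → ℝ), μ = t ∧ v ⬝ᵥ v = 1 ∧ B *ᵥ v = t • v := by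
  rw [mem_spectrum_iff_isRoot_charpoly] at hμ
  have h1 : (C.map Complex.ofReal).charpoly = B.charpoly.map Complex.ofRealHom := by
    rw [← hC]; exact charpoly_map C Complex.ofRealHom
  rw [h1, hB.charpoly_eq, Polynomial.IsRoot, Polynomial.eval_map, Polynomial.eval₂_finsetProd,
    Finset.prod_eq_zero_iff] at hμ
  obtain ⟨i, -, hi⟩ := hμ
  refine ⟨hB.eigenvalues i, (hB.eigenvectorBasis i).ofLp, ?_, ?_, hB.mulVec_eigenvectorBasis i⟩
  · simpa [sub_eq_zero] using hi
  · have := hB.eigenvectorBasis.orthonormal.1 i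
    rw [EuclideanSpace.norm_eq, Real.sqrt_eq_one] at this
    simpa [dotProduct, sq] using this

end Spectrum

section SingularValues

variable {m k : ℕ}

lemma euclNorm_nonneg (x : Fin k → ℝ) : 0 ≤ euclNorm x := Real.sqrt_nonneg _

lemma euclNorm_sq (x : Fin k → ℝ) : euclNorm x ^ 2 = x ⬝ᵥ x := by
  rw [euclNorm, Real.sq_sqrt (Finset.sum_nonneg fun _ _ => sq_nonneg _)]
  simp [dotProduct, sq]

lemma euclNorm_eq_sqrt (x : Fin k → ℝ) : euclNorm x = √(x ⬝ᵥ x) := by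
  rw [← euclNorm_sq, Real.sqrt_sq (euclNorm_nonneg x)]

lemma euclNorm_smul (c : ℝ) (x : Fin k → ℝ) : euclNorm (c • x) = |c| * euclNorm x := by
  rw [euclNorm_eq_sqrt, euclNorm_eq_sqrt, smul_dotProduct, dotProduct_smul, smul_eq_mul,
    smul_eq_mul, ← mul_assoc, Real.sqrt_mul (mul_self_nonneg c), Real.sqrt_mul_self_eq_abs]

lemma euclNorm_eq_zero {x : Fin k → ℝ} : euclNorm x = 0 ↔ x = 0 := by
  rw [← sq_eq_zero_iff, euclNorm_sq, dotProduct_self_eq_zero]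

lemma exists_euclNorm_mulVec_le (M : Matrix (Fin m) (Fin k) ℝ) :
    ∃ K, ∀ x, euclNorm x = 1 → euclNorm (M *ᵥ x) ≤ K := by
  refine ⟨√(∑ i, M i ⬝ᵥ M i), fun x hx => ?_⟩
  rw [euclNorm_eq_sqrt]
  refine Real.sqrt_le_sqrt (Finset.sum_le_sum fun i _ => ?_)
  have := dotProduct_sq_le (M i) x
  rw [← euclNorm_sq x, hx] at this
  simpa [sq, mulVec] using this

lemma sigmaMax_nonneg (M : Matrix (Fin m) (Fin k) ℝ) : 0 ≤ sigmaMax M := by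
  refine Real.sSup_nonneg ?_
  rintro _ ⟨x, -, rfl⟩
  exact euclNorm_nonneg _

lemma sigmaMin_nonneg (M : Matrix (Fin m) (Fin k) ℝ) : 0 ≤ sigmaMin M := by
  refine Real.sInf_nonneg ?_
  rintro _ ⟨x, -, rfl⟩
  exact euclNorm_nonneg _

lemma euclNorm_mulVec_le (M : Matrix (Fin m) (Fin k) ℝ) (x : Fin k → ℝ) :
    euclNorm (M *ᵥ x) ≤ sigmaMax M * euclNorm x := by
  rcases eq_or_ne x 0 with rfl | hx
  · simp [euclNorm]
  have hpos : 0 < euclNorm x :=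
    (euclNorm_nonneg x).lt_of_ne' (mt euclNorm_eq_zero.mp hx)
  have hbdd : BddAbove {c : ℝ | ∃ x : Fin k → ℝ, euclNorm x = 1 ∧ c = euclNorm (M.mulVec x)} := by
    obtain ⟨K, hK⟩ := exists_euclNorm_mulVec_le M
    refine ⟨K, ?_⟩
    rintro _ ⟨z, hz, rfl⟩
    exact hK z hz
  have h := le_csSup hbdd ⟨(euclNorm x)⁻¹ • x, by
    rw [euclNorm_smul, abs_of_pos (inv_pos.mpr hpos), inv_mul_cancel₀ hpos.ne'], rfl⟩
  rw [mulVec_smul, euclNorm_smul, abs_of_pos (inv_pos.mpr hpos), inv_mul_le_iff₀ hpos,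
    mul_comm] at h
  exact h

lemma mulVec_dotProduct_self_le_sigmaMax (M : Matrix (Fin m) (Fin k) ℝ) (x : Fin k → ℝ) :
    M *ᵥ x ⬝ᵥ M *ᵥ x ≤ sigmaMax M ^ 2 * (x ⬝ᵥ x) := by
  rw [← euclNorm_sq, ← euclNorm_sq, ← mul_pow]
  exact pow_le_pow_left₀ (euclNorm_nonneg _) (euclNorm_mulVec_le M x) 2

lemma sigmaMin_le (M : Matrix (Fin m) (Fin k) ℝ) {x : Fin k → ℝ} (hx : euclNorm x = 1) :
    sigmaMin M ≤ euclNorm (M *ᵥ x) := by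
  refine csInf_le ⟨0, ?_⟩ ⟨x, hx, rfl⟩
  rintro _ ⟨z, -, rfl⟩
  exact euclNorm_nonneg _

/-- A square matrix with non-zero smallest singular value is invertible. -/
lemma isUnit_det_of_sigmaMin_ne_zero {M : Matrix (Fin k) (Fin k) ℝ} (hM : sigmaMin M ≠ 0) :
    IsUnit M.det := by
  rw [isUnit_iff_ne_zero]
  intro h
  obtain ⟨x, hx, hMx⟩ := exists_mulVec_eq_zero_iff.mpr h
  have hpos : 0 < euclNorm x :=
    (euclNorm_nonneg x).lt_of_ne' (mt euclNorm_eq_zero.mp hx)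
  have := sigmaMin_le M (x := (euclNorm x)⁻¹ • x) (by
    rw [euclNorm_smul, abs_of_pos (inv_pos.mpr hpos), inv_mul_cancel₀ hpos.ne'])
  rw [mulVec_smul, hMx, smul_zero, euclNorm_eq_zero.mpr rfl] at this
  exact hM (this.antisymm (sigmaMin_nonneg M))

/-- The smallest singular value of a product of (transposed) matrices with orthonormal columns is
at most one. -/
lemma sigmaMin_transpose_mul_le_one {n : ℕ} (hk : 0 < k) {Z : Matrix (Fin n) (Fin m) ℝ}
    {V : Matrix (Fin n) (Fin k) ℝ} (hZ : Zᵀ * Z = 1) (hV : Vᵀ * V = 1) :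
    sigmaMin (Zᵀ * V) ≤ 1 := by
  have hx : euclNorm (Pi.single (⟨0, hk⟩ : Fin k) (1 : ℝ)) = 1 := by
    rw [euclNorm_eq_sqrt]; simp
  refine (sigmaMin_le _ hx).trans ?_
  rw [← sq_le_one_iff₀ (euclNorm_nonneg _), euclNorm_sq, ← mulVec_mulVec]
  refine (transpose_mulVec_dotProduct_self_le zero_le_one (fun x => ?_) _).trans ?_
  · rw [mulVec_dotProduct_self_of_transpose_mul_self hZ, one_mul]
  · rw [mulVec_dotProduct_self_of_transpose_mul_self hV, ← euclNorm_sq, hx]; norm_num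

/-- `‖x‖² ≤ ‖(FᵀF)⁻¹‖₂ ‖F x‖²`. -/
lemma dotProduct_self_le_sigmaMax_inv_mul {F : Matrix (Fin m) (Fin k) ℝ}
    (hF : IsUnit (Fᵀ * F).det) (x : Fin k → ℝ) :
    x ⬝ᵥ x ≤ sigmaMax (Fᵀ * F)⁻¹ * (F *ᵥ x ⬝ᵥ F *ᵥ x) := by
  set G := (Fᵀ * F)⁻¹ with hG
  have hEG (z : Fin k → ℝ) : z ⬝ᵥ x = F *ᵥ z ⬝ᵥ F *ᵥ (G *ᵥ x) := by
    rw [mulVec_dotProduct_eq, mulVec_mulVec, mulVec_mulVec, mul_nonsing_inv _ hF, one_mulVec]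
  have h1 := dotProduct_sq_le (F *ᵥ x) (F *ᵥ (G *ᵥ x))
  rw [← hEG, ← hEG] at h1
  have h2 : G *ᵥ x ⬝ᵥ x ≤ sigmaMax G * (x ⬝ᵥ x) := by
    refine le_of_sq_le_sq ((dotProduct_sq_le (G *ᵥ x) x).trans ?_)
      (mul_nonneg (sigmaMax_nonneg G) (dotProduct_self_nonneg_real x))
    rw [mul_pow, sq (x ⬝ᵥ x), ← mul_assoc]
    exact mul_le_mul_of_nonneg_right (mulVec_dotProduct_self_le_sigmaMax G x)
      (dotProduct_self_nonneg_real x)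
  have h3 := dotProduct_self_nonneg_real (F *ᵥ x)
  have h4 := sigmaMax_nonneg G
  rcases (dotProduct_self_nonneg_real x).eq_or_lt with h | h
  · rw [← h]; positivity
  · nlinarith [mul_le_mul_of_nonneg_left h2 h3]

end SingularValues

section Spectral

variable {ι : Type*} [Fintype ι] [DecidableEq ι] {A U : Matrix ι ι ℝ} {lam : ι → ℝ}

lemma eq_mul_diagonal_mul_transpose (hU : Uᵀ * U = 1) (hAU : A * U = U * diagonal lam) :
    A = U * diagonal lam * Uᵀ := by
  rw [← hAU, Matrix.mul_assoc, mul_eq_one_comm.mp hU, Matrix.mul_one]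

lemma pos_of_posDef_of_mul_eq_mul_diagonal (hA : A.PosDef) (hU : Uᵀ * U = 1)
    (hAU : A * U = U * diagonal lam) (i : ι) : 0 < lam i := by
  have hx : U *ᵥ Pi.single i 1 ≠ 0 := by
    intro h
    have h1 := mulVec_dotProduct_self_of_transpose_mul_self hU (Pi.single i 1)
    simp [h] at h1
  have h := hA.dotProduct_mulVec_pos hx
  rw [star_trivial, mulVec_mulVec, hAU, mulVec_dotProduct_eq, mulVec_mulVec, ← Matrix.mul_assoc,
    hU, Matrix.one_mul] at h
  simpa using h

/-- The quadratic form of `A` in an orthonormal eigenbasis. -/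
lemma dotProduct_mulVec_eq_sum (hU : Uᵀ * U = 1) (hAU : A * U = U * diagonal lam) (y : ι → ℝ) :
    y ⬝ᵥ A *ᵥ y = ∑ i, lam i * (Uᵀ *ᵥ y) i ^ 2 := by
  rw [eq_mul_diagonal_mul_transpose hU hAU, ← mulVec_mulVec, ← mulVec_mulVec,
    ← transpose_transpose U, ← mulVec_dotProduct_eq, transpose_transpose, dotProduct]
  refine Finset.sum_congr rfl fun i _ => ?_
  rw [mulVec_diagonal]
  ring

/-- A positive definite matrix with a given eigenbasis has a symmetric square root acting
diagonally on that eigenbasis. -/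
lemma exists_sqrt_of_mul_eq_mul_diagonal (hA : A.PosDef) (hU : Uᵀ * U = 1)
    (hAU : A * U = U * diagonal lam) :
    ∃ S : Matrix ι ι ℝ, Sᵀ = S ∧ S * S = A ∧
      ∀ x i, (Uᵀ *ᵥ (S *ᵥ x)) i = √(lam i) * (Uᵀ *ᵥ x) i := by
  have hD : diagonal (fun i => √(lam i)) * diagonal (fun i => √(lam i)) = diagonal lam := by
    rw [diagonal_mul_diagonal]
    congr 1
    ext i
    exact Real.mul_self_sqrt (pos_of_posDef_of_mul_eq_mul_diagonal hA hU hAU i).le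
  refine ⟨U * diagonal (fun i => √(lam i)) * Uᵀ, ?_, ?_, fun x i => ?_⟩
  · simp [transpose_mul, Matrix.mul_assoc]
  · rw [eq_mul_diagonal_mul_transpose hU hAU, ← hD]
    simp only [Matrix.mul_assoc]
    rw [← Matrix.mul_assoc Uᵀ U, hU, Matrix.one_mul]
  · rw [mulVec_mulVec, Matrix.mul_assoc, ← Matrix.mul_assoc Uᵀ U, hU, Matrix.one_mul,
      ← mulVec_mulVec, mulVec_diagonal]

end Spectral

section SplitBasis

variable {r s : ℕ}

/-- Splitting the coordinates in an orthonormal basis into two blocks. -/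
lemma dotProduct_self_eq_add_of_submatrix {U : Matrix (Fin (r + s)) (Fin (r + s)) ℝ}
    (hU : Uᵀ * U = 1) (y : Fin (r + s) → ℝ) :
    y ⬝ᵥ y = (U.submatrix id (Fin.castAdd s))ᵀ *ᵥ y ⬝ᵥ (U.submatrix id (Fin.castAdd s))ᵀ *ᵥ y +
      (U.submatrix id (Fin.natAdd r))ᵀ *ᵥ y ⬝ᵥ (U.submatrix id (Fin.natAdd r))ᵀ *ᵥ y := by
  have h : Uᵀᵀ * Uᵀ = 1 := by rw [transpose_transpose, mul_eq_one_comm.mp hU]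
  rw [← mulVec_dotProduct_self_of_transpose_mul_self h]
  exact Fin.sum_univ_add _

lemma submatrix_transpose_mul_self {ι κ : Type*} [Fintype ι] [DecidableEq ι] [DecidableEq κ]
    {U : Matrix ι ι ℝ} (hU : Uᵀ * U = 1) {f : κ → ι} (hf : Function.Injective f) :
    (U.submatrix id f)ᵀ * U.submatrix id f = 1 := by
  rw [transpose_submatrix, ← submatrix_mul _ _ f id f Function.bijective_id, hU, submatrix_one _ hf]

end SplitBasis

/-- The orthogonal projection `F (FᵀF)⁻¹ Fᵀ` onto the range of `F` differs from the projection
`V Vᵀ` by at most `√K` in norm if `‖Fc‖² - ‖VᵀFc‖² ≤ K ‖Fc‖²` for all `c` and `VᵀF` is onto. -/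
lemma dotProduct_range_projection_sub_sq_le {ι κ : Type*} [Fintype ι] [Fintype κ]
    [DecidableEq κ] {F V : Matrix ι κ ℝ} (hF : IsUnit (Fᵀ * F).det) (hV : Vᵀ * V = 1)
    {K : ℝ} (hK : 0 ≤ K)
    (hgap : ∀ c, F *ᵥ c ⬝ᵥ F *ᵥ c - Vᵀ *ᵥ (F *ᵥ c) ⬝ᵥ Vᵀ *ᵥ (F *ᵥ c) ≤ K * (F *ᵥ c ⬝ᵥ F *ᵥ c))
    (hsurj : ∀ z, ∃ c, Vᵀ *ᵥ (F *ᵥ c) = z) (y : ι → ℝ) :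
    (y ⬝ᵥ (F * (Fᵀ * F)⁻¹ * Fᵀ) *ᵥ y - Vᵀ *ᵥ y ⬝ᵥ Vᵀ *ᵥ y) ^ 2 ≤ K * (y ⬝ᵥ y) ^ 2 := by
  have hQF : F * (Fᵀ * F)⁻¹ * Fᵀ * F = F := by
    rw [Matrix.mul_assoc, Matrix.mul_assoc, nonsing_inv_mul _ hF, Matrix.mul_one]
  have hQt : (F * (Fᵀ * F)⁻¹ * Fᵀ)ᵀ = F * (Fᵀ * F)⁻¹ * Fᵀ := by
    simp [transpose_mul, transpose_nonsing_inv, Matrix.mul_assoc]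
  have hVP : y ⬝ᵥ (V * Vᵀ) *ᵥ y = Vᵀ *ᵥ y ⬝ᵥ Vᵀ *ᵥ y := by
    rw [mulVec_dotProduct_eq, transpose_transpose, mulVec_mulVec]
  rw [← hVP]
  refine dotProduct_projection_sub_sq_le (by simp) ?_ hQt ?_ hK (fun q hq => ?_) (fun z => ?_) y
  · rw [Matrix.mul_assoc, ← Matrix.mul_assoc Vᵀ, hV, Matrix.one_mul]
  · rw [← Matrix.mul_assoc, ← Matrix.mul_assoc, hQF]
  · rw [Matrix.mul_assoc, ← mulVec_mulVec] at hq
    rw [← mulVec_mulVec, mulVec_dotProduct_self_of_transpose_mul_self hV, ← hq]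
    exact hgap _
  · obtain ⟨c, hc⟩ := hsurj (Vᵀ *ᵥ z)
    refine ⟨F *ᵥ c, by rw [mulVec_mulVec, hQF], ?_⟩
    rw [← mulVec_mulVec, hc, mulVec_mulVec]

/-- Same context as Statements 8–9, but with the coarse correction
preconditioner `P_C = I + Z E⁻¹ Zᵀ`.  If `cos θ ≠ 0` then every eigenvalue `μ` of
`P_C A` is real and satisfies
`min{1 + λ_min(Λ), λ_min(Λ_⊥)} − ε_C ≤ μ ≤ max{1 + λ_max(Λ), λ_max(Λ_⊥)} + ε_C`,
where `ε_C = (1/2)(λ_max(Λ_⊥) ‖E⁻¹‖₂ + 1) tan θ + sin θ + sin² θ`. -/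
theorem stmt_12 (r s : ℕ) (hr : 0 < r) (hs : 0 < s)
    (A : Matrix (Fin (r + s)) (Fin (r + s)) ℝ) (hA : A.PosDef)
    (lam : Fin (r + s) → ℝ) (U : Matrix (Fin (r + s)) (Fin (r + s)) ℝ)
    (hU : Uᵀ * U = 1) (hAU : A * U = U * Matrix.diagonal lam)
    (V : Matrix (Fin (r + s)) (Fin r) ℝ) (hV : V = U.submatrix id (Fin.castAdd s))
    (Vp : Matrix (Fin (r + s)) (Fin s) ℝ) (hVp : Vp = U.submatrix id (Fin.natAdd r))
    (Z : Matrix (Fin (r + s)) (Fin r) ℝ) (hZ : Zᵀ * Z = 1)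
    (sinθ : ℝ) (hsin : sinθ = sigmaMax (Zᵀ * Vp))
    (cosθ : ℝ) (hcos : cosθ = sigmaMin (Zᵀ * V)) (hcos0 : cosθ ≠ 0)
    (tanθ : ℝ) (htan : tanθ = sinθ / cosθ)
    (E : Matrix (Fin r) (Fin r) ℝ) (hE : E = Zᵀ * A * Z)
    (P : Matrix (Fin (r + s)) (Fin (r + s)) ℝ) (hP : P = 1 + Z * E⁻¹ * Zᵀ)
    (lamMax : ℝ) (hlamMax : lamMax = ⨆ i : Fin r, lam (Fin.castAdd s i))
    (lamMin : ℝ) (hlamMin : lamMin = ⨅ i : Fin r, lam (Fin.castAdd s i))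
    (lamMaxPerp : ℝ) (hlamMaxPerp : lamMaxPerp = ⨆ i : Fin s, lam (Fin.natAdd r i))
    (lamMinPerp : ℝ) (hlamMinPerp : lamMinPerp = ⨅ i : Fin s, lam (Fin.natAdd r i))
    (εC : ℝ)
    (hεC : εC = (1 / 2) * (lamMaxPerp * sigmaMax E⁻¹ + 1) * tanθ + sinθ + sinθ ^ 2) :
    ∀ μ ∈ spectrum ℂ ((P * A).map Complex.ofReal),
      μ.im = 0 ∧
      min (1 + lamMin) lamMinPerp - εC ≤ μ.re ∧
      μ.re ≤ max (1 + lamMax) lamMaxPerp + εC := by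
  subst hV hVp hE hP hsin hcos htan
  have hlam := pos_of_posDef_of_mul_eq_mul_diagonal hA hU hAU
  obtain ⟨S, hSt, hSS, hSU⟩ := exists_sqrt_of_mul_eq_mul_diagonal hA hU hAU
  set V := U.submatrix id (Fin.castAdd s) with hV
  set Vp := U.submatrix id (Fin.natAdd r) with hVp
  have hVV : Vᵀ * V = 1 := submatrix_transpose_mul_self hU (Fin.castAdd_injective r s)
  have hE : Zᵀ * A * Z = (S * Z)ᵀ * (S * Z) := by
    rw [transpose_mul, hSt, ← hSS]
    simp only [Matrix.mul_assoc]
  have hZinj : Function.Injective Z.mulVec := fun x z h => by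
    simpa [mulVec_mulVec, hZ] using congrArg (Zᵀ *ᵥ ·) h
  have hEunit : IsUnit ((S * Z)ᵀ * (S * Z)).det := by
    rw [← hE, ← isUnit_iff_isUnit_det]
    simpa using (hA.conjTranspose_mul_mul_same hZinj).isUnit
  have hle (i : Fin r) : lam (Fin.castAdd s i) ≤ lamMax :=
    hlamMax ▸ le_ciSup (f := fun i => lam (Fin.castAdd s i)) (Set.finite_range _).bddAbove i
  have hge (i : Fin r) : lamMin ≤ lam (Fin.castAdd s i) :=
    hlamMin ▸ ciInf_le (f := fun i => lam (Fin.castAdd s i)) (Set.finite_range _).bddBelow i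
  have hlep (i : Fin s) : lam (Fin.natAdd r i) ≤ lamMaxPerp :=
    hlamMaxPerp ▸ le_ciSup (f := fun i => lam (Fin.natAdd r i)) (Set.finite_range _).bddAbove i
  have hgep (i : Fin s) : lamMinPerp ≤ lam (Fin.natAdd r i) :=
    hlamMinPerp ▸ ciInf_le (f := fun i => lam (Fin.natAdd r i)) (Set.finite_range _).bddBelow i
  have hperp : 0 < lamMaxPerp := (hlam _).trans_le (hlep ⟨0, hs⟩)
  rw [hE] at hεC ⊢
  set g := sigmaMax ((S * Z)ᵀ * (S * Z))⁻¹ with hg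
  have hg0 : 0 ≤ g := sigmaMax_nonneg _
  set σ := sigmaMax (Zᵀ * Vp) with hσ
  have hσ0 : 0 ≤ σ := sigmaMax_nonneg _
  have hK : 0 ≤ lamMaxPerp * g * σ ^ 2 := by positivity
  -- the gap between the range of `S * Z` and the span of the first eigenvectors
  have hgap (c : Fin r → ℝ) :
      (S * Z) *ᵥ c ⬝ᵥ (S * Z) *ᵥ c - Vᵀ *ᵥ ((S * Z) *ᵥ c) ⬝ᵥ Vᵀ *ᵥ ((S * Z) *ᵥ c) ≤
        lamMaxPerp * g * σ ^ 2 * ((S * Z) *ᵥ c ⬝ᵥ (S * Z) *ᵥ c) := by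
    have h1 : Vpᵀ *ᵥ ((S * Z) *ᵥ c) ⬝ᵥ Vpᵀ *ᵥ ((S * Z) *ᵥ c) ≤
        lamMaxPerp * ((Zᵀ * Vp)ᵀ *ᵥ c ⬝ᵥ (Zᵀ * Vp)ᵀ *ᵥ c) := by
      rw [dotProduct, dotProduct, Finset.mul_sum]
      refine Finset.sum_le_sum fun i _ => ?_
      have h2 : (Vpᵀ *ᵥ ((S * Z) *ᵥ c)) i =
          √(lam (Fin.natAdd r i)) * ((Zᵀ * Vp)ᵀ *ᵥ c) i := by
        rw [transpose_mul, transpose_transpose, ← mulVec_mulVec, ← mulVec_mulVec]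
        exact hSU (Z *ᵥ c) (Fin.natAdd r i)
      rw [h2, mul_mul_mul_comm, Real.mul_self_sqrt (hlam _).le]
      exact mul_le_mul_of_nonneg_right (hlep i) (mul_self_nonneg _)
    have h3 := transpose_mulVec_dotProduct_self_le (sq_nonneg σ)
      (mulVec_dotProduct_self_le_sigmaMax (Zᵀ * Vp)) c
    have h4 := dotProduct_self_le_sigmaMax_inv_mul hEunit c
    have h5 := dotProduct_self_eq_add_of_submatrix hU ((S * Z) *ᵥ c)
    calc _ = Vpᵀ *ᵥ ((S * Z) *ᵥ c) ⬝ᵥ Vpᵀ *ᵥ ((S * Z) *ᵥ c) := by rw [h5]; ring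
      _ ≤ lamMaxPerp * (σ ^ 2 * (g * ((S * Z) *ᵥ c ⬝ᵥ (S * Z) *ᵥ c))) := by
        refine h1.trans (mul_le_mul_of_nonneg_left (h3.trans ?_) hperp.le)
        exact mul_le_mul_of_nonneg_left h4 (sq_nonneg σ)
      _ = _ := by ring
  have hsurj (z : Fin r → ℝ) : ∃ c, Vᵀ *ᵥ ((S * Z) *ᵥ c) = z := by
    have hunit : IsUnit (Vᵀ * Z).det := by
      rw [← det_transpose, transpose_mul, transpose_transpose]
      exact isUnit_det_of_sigmaMin_ne_zero hcos0
    refine ⟨(Vᵀ * Z)⁻¹ *ᵥ fun i => z i / √(lam (Fin.castAdd s i)), ?_⟩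
    ext i
    rw [← mulVec_mulVec]
    refine (hSU _ (Fin.castAdd s i)).trans ?_
    have h : Vᵀ *ᵥ (Z *ᵥ ((Vᵀ * Z)⁻¹ *ᵥ fun i => z i / √(lam (Fin.castAdd s i)))) =
        fun i => z i / √(lam (Fin.castAdd s i)) := by
      rw [mulVec_mulVec, mulVec_mulVec, mul_nonsing_inv _ hunit, one_mulVec]
    refine (congrArg (√(lam (Fin.castAdd s i)) * ·) (congrFun h i)).trans ?_
    exact mul_div_cancel₀ _ (Real.sqrt_pos.mpr (hlam _)).ne'
  have hε : √(lamMaxPerp * g * σ ^ 2) ≤ εC := by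
    have hcpos : 0 < sigmaMin (Zᵀ * V) := (sigmaMin_nonneg _).lt_of_ne' hcos0
    have htan : σ ≤ σ / sigmaMin (Zᵀ * V) :=
      le_div_self hσ0 hcpos (sigmaMin_transpose_mul_le_one hr hZ hVV)
    have h1 : √(lamMaxPerp * g) ≤ 1 / 2 * (lamMaxPerp * g + 1) := by
      have h2 := Real.sq_sqrt (mul_nonneg hperp.le hg0)
      nlinarith [sq_nonneg (√(lamMaxPerp * g) - 1)]
    rw [Real.sqrt_mul (mul_nonneg hperp.le hg0), Real.sqrt_sq hσ0, hεC]
    have h3 := mul_le_mul h1 htan hσ0 (by positivity)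
    nlinarith [sq_nonneg σ]
  intro μ hμ
  have hQt : ((S * Z) * ((S * Z)ᵀ * (S * Z))⁻¹ * (S * Z)ᵀ)ᵀ =
      (S * Z) * ((S * Z)ᵀ * (S * Z))⁻¹ * (S * Z)ᵀ := by
    simp only [transpose_mul, transpose_nonsing_inv, transpose_transpose, Matrix.mul_assoc]
  have hB : (A + (S * Z) * ((S * Z)ᵀ * (S * Z))⁻¹ * (S * Z)ᵀ).IsHermitian := by
    rw [IsHermitian, conjTranspose_add, hA.isHermitian, conjTranspose_eq_transpose_of_trivial, hQt]
  have hchar : ((1 + Z * ((S * Z)ᵀ * (S * Z))⁻¹ * Zᵀ) * A).charpoly =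
      (A + (S * Z) * ((S * Z)ᵀ * (S * Z))⁻¹ * (S * Z)ᵀ).charpoly := by
    generalize ((S * Z)ᵀ * (S * Z))⁻¹ = G
    rw [← hSS, ← Matrix.mul_assoc, charpoly_mul_comm, transpose_mul, hSt]
    congr 1
    simp only [Matrix.add_mul, Matrix.mul_add, Matrix.one_mul, Matrix.mul_assoc]
  obtain ⟨t, v, rfl, hv, hBv⟩ := exists_eigenvector_of_mem_spectrum_map hB hchar hμ
  have ht : t = v ⬝ᵥ A *ᵥ v +
      v ⬝ᵥ ((S * Z) * ((S * Z)ᵀ * (S * Z))⁻¹ * (S * Z)ᵀ) *ᵥ v := by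
    rw [← dotProduct_add, ← add_mulVec, hBv, dotProduct_smul, hv, smul_eq_mul, mul_one]
  have hsq := dotProduct_range_projection_sub_sq_le hEunit hVV hK hgap hsurj v
  rw [hv, one_pow, mul_one] at hsq
  have hpert := abs_le.mp ((Real.abs_le_sqrt hsq).trans hε)
  have hsplit := dotProduct_self_eq_add_of_submatrix hU v
  rw [← hV, ← hVp, hv] at hsplit
  have hform : v ⬝ᵥ A *ᵥ v + Vᵀ *ᵥ v ⬝ᵥ Vᵀ *ᵥ v =
      ∑ i, (1 + lam (Fin.castAdd s i)) * (Vᵀ *ᵥ v) i ^ 2 +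
        ∑ i, lam (Fin.natAdd r i) * (Vpᵀ *ᵥ v) i ^ 2 := by
    rw [dotProduct_mulVec_eq_sum hU hAU, Fin.sum_univ_add, add_right_comm, dotProduct,
      ← Finset.sum_add_distrib]
    congr 1
    refine Finset.sum_congr rfl fun i _ => ?_
    change lam _ * (Vᵀ *ᵥ v) i ^ 2 + _ = _
    ring
  have hsplit' : ∑ i, (Vᵀ *ᵥ v) i ^ 2 + ∑ i, (Vpᵀ *ᵥ v) i ^ 2 = 1 := by
    simpa only [dotProduct, sq] using hsplit.symm
  refine ⟨Complex.ofReal_im t, ?_, ?_⟩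
  · rw [Complex.ofReal_re]
    have h : min (1 + lamMin) lamMinPerp * 1 ≤ v ⬝ᵥ A *ᵥ v + Vᵀ *ᵥ v ⬝ᵥ Vᵀ *ᵥ v := by
      rw [hform, ← hsplit', mul_add, Finset.mul_sum, Finset.mul_sum]
      refine add_le_add (Finset.sum_le_sum fun i _ => ?_) (Finset.sum_le_sum fun i _ => ?_)
      · exact mul_le_mul_of_nonneg_right
          ((min_le_left _ _).trans (by linarith [hge i])) (sq_nonneg _)
      · exact mul_le_mul_of_nonneg_right ((min_le_right _ _).trans (hgep i)) (sq_nonneg _)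
    linarith [hpert.1]
  · rw [Complex.ofReal_re]
    have h : v ⬝ᵥ A *ᵥ v + Vᵀ *ᵥ v ⬝ᵥ Vᵀ *ᵥ v ≤ max (1 + lamMax) lamMaxPerp * 1 := by
      rw [hform, ← hsplit', mul_add, Finset.mul_sum, Finset.mul_sum]
      refine add_le_add (Finset.sum_le_sum fun i _ => ?_) (Finset.sum_le_sum fun i _ => ?_)
      · exact mul_le_mul_of_nonneg_right
          (le_trans (by linarith [hle i]) (le_max_left _ _)) (sq_nonneg _)
      · exact mul_le_mul_of_nonneg_right ((hlep i).trans (le_max_right _ _)) (sq_nonneg _)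
    linarith [hpert.2]
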